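/- For every (w_h, χ_h) ∈ U_h, the function w̃_h := Θ_h(w_h, χ_h) − w_h belongs to V_h and satisfies ‖w̃_h‖_{V,k} ≤ C_B k^{1/2}‖Dw_h‖_W + ‖Θ_h(0, χ_h)‖_{V,k}; in particular ‖w̃_h‖_{V,k} ≤ C|||(w_h, χ_h)|||_k with C depending only on C_B and T. (Abstract form of estimate (2.7)/(eq:wTildeK) in the proof of Lemma lem:b.) -/

import Mathlib

noncomputable section

open scoped RealInnerProductSpace

variable {H W V S : Type*} [NormedAddCommGroup H] [InnerProductSpace ℝ H]
  [NormedAddCommGroup W] [InnerProductSpace ℝ W]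
  [AddCommGroup V] [Module ℝ V] [AddCommGroup S] [Module ℝ S]

/-- The inner product `⟨v, w⟩_{V,k} = (1/k)⟨v,w⟩_H + ⟨Dv,Dw⟩_W` on `V ⊆ H`
(the inclusion `V ⊆ H` is realized by the injective linear map `jH`). -/
def ipVk (jH : V →ₗ[ℝ] H) (D : V →ₗ[ℝ] W) (k : ℝ) (v w : V) : ℝ :=
  (1 / k) * ⟪jH v, jH w⟫ + ⟪D v, D w⟫

/-- The norm `‖v‖_{V,k}` induced by `⟨·,·⟩_{V,k}`. -/
def nVk (jH : V →ₗ[ℝ] H) (D : V →ₗ[ℝ] W) (k : ℝ) (v : V) : ℝ :=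
  Real.sqrt (ipVk jH D k v v)

/-- The bilinear form `b((u,σ), v) = ⟨Du, Dv⟩_W + ⟨Bu, v⟩_H − d(σ, v)`. -/
def bForm (jH : V →ₗ[ℝ] H) (D : V →ₗ[ℝ] W) {X : Submodule ℝ V}
    (B : ↥X →ₗ[ℝ] H) (d : S →ₗ[ℝ] V →ₗ[ℝ] ℝ) (u : ↥X × S) (v : V) : ℝ :=
  ⟪D (u.1 : V), D v⟫ + ⟪B u.1, jH v⟫ - d u.2 v

/-- The bilinear form `a((u,σ), v) = (1/k)⟨u, v⟩_H + b((u,σ), v)`. -/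
def aForm (jH : V →ₗ[ℝ] H) (D : V →ₗ[ℝ] W) {X : Submodule ℝ V}
    (B : ↥X →ₗ[ℝ] H) (d : S →ₗ[ℝ] V →ₗ[ℝ] ℝ) (k : ℝ) (u : ↥X × S) (v : V) : ℝ :=
  (1 / k) * ⟪jH (u.1 : V), jH v⟫ + bForm jH D B d u v

/-- The norm `‖σ‖_{-1/2,k} = sup_{0 ≠ v ∈ V} d(σ, v)/‖v‖_{V,k}`. -/
def negNorm (jH : V →ₗ[ℝ] H) (D : V →ₗ[ℝ] W) (d : S →ₗ[ℝ] V →ₗ[ℝ] ℝ)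
    (k : ℝ) (σ : S) : ℝ :=
  ⨆ v : {v : V // v ≠ 0}, d σ (v : V) / nVk jH D k (v : V)

/-- Membership in `U_h = X_h × S_h ⊆ U = X × S`. -/
def memUh {X : Submodule ℝ V} (Xh : Submodule ℝ V) (Sh : Submodule ℝ S)
    (u : ↥X × S) : Prop :=
  (u.1 : V) ∈ Xh ∧ u.2 ∈ Sh

/-- `Θ` is the (discrete) trial-to-test operator: it maps into `V_h` and satisfies
`⟨Θ𝒖, v_h⟩_{V,k} = a(𝒖, v_h)` for all `v_h ∈ V_h`. -/
def IsTrialToTest (jH : V →ₗ[ℝ] H) (D : V →ₗ[ℝ] W) {X : Submodule ℝ V}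
    (B : ↥X →ₗ[ℝ] H) (d : S →ₗ[ℝ] V →ₗ[ℝ] ℝ) (k : ℝ) (Vh : Submodule ℝ V)
    (Θ : ↥X × S → V) : Prop :=
  ∀ u : ↥X × S, Θ u ∈ Vh ∧ ∀ v ∈ Vh, ipVk jH D k (Θ u) v = aForm jH D B d k u v

/-- The energy (semi-)norm `|||𝒖|||_k² = ‖Du‖_W² + ‖Θ(0,σ)‖_{V,k}²`. -/
def enormK (jH : V →ₗ[ℝ] H) (D : V →ₗ[ℝ] W) {X : Submodule ℝ V}
    (Θ : ↥X × S → V) (k : ℝ) (u : ↥X × S) : ℝ :=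
  Real.sqrt (‖D (u.1 : V)‖ ^ 2 + nVk jH D k (Θ (0, u.2)) ^ 2)

/-- The trial norm `‖𝒖‖_{U,k}² = ‖Du‖_W² + ‖σ‖_{-1/2,k}²`. -/
def UnormK (jH : V →ₗ[ℝ] H) (D : V →ₗ[ℝ] W) {X : Submodule ℝ V}
    (d : S →ₗ[ℝ] V →ₗ[ℝ] ℝ) (k : ℝ) (u : ↥X × S) : ℝ :=
  Real.sqrt (‖D (u.1 : V)‖ ^ 2 + negNorm jH D d k u.2 ^ 2)

theorem aux_le {a b : ℝ} (h : a ^ 2 ≤ b ^ 2) (hb : 0 ≤ b) : a ≤ b :=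
  abs_le_of_sq_le_sq' h hb |>.2

theorem aux_nVk_sq (jH : V →ₗ[ℝ] H) (D : V →ₗ[ℝ] W) (k : ℝ) (hk : 0 < k) (v : V) :
    nVk jH D k v ^ 2 = (1 / k) * ‖jH v‖ ^ 2 + ‖D v‖ ^ 2 := by
  have e : ipVk jH D k v v = (1 / k) * ‖jH v‖ ^ 2 + ‖D v‖ ^ 2 := by
    simp only [ipVk, real_inner_self_eq_norm_sq]
  rw [nVk, e, Real.sq_sqrt (by positivity)]

theorem aux_cs (jH : V →ₗ[ℝ] H) (D : V →ₗ[ℝ] W) (k : ℝ) (hk : 0 < k) (v w : V) :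
    ipVk jH D k v w ≤ nVk jH D k v * nVk jH D k w := by
  have h1 := real_inner_le_norm (jH v) (jH w)
  have h2 := real_inner_le_norm (D v) (D w)
  have hk' : 0 < 1 / k := by positivity
  have h3 : ipVk jH D k v w ≤ (1 / k) * (‖jH v‖ * ‖jH w‖) + ‖D v‖ * ‖D w‖ := by
    unfold ipVk
    gcongr
  refine h3.trans ?_
  have hv : 0 ≤ nVk jH D k v := Real.sqrt_nonneg _
  have hw : 0 ≤ nVk jH D k w := Real.sqrt_nonneg _
  refine aux_le ?_ (mul_nonneg hv hw)
  rw [mul_pow, aux_nVk_sq jH D k hk, aux_nVk_sq jH D k hk]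
  nlinarith [mul_nonneg hk'.le (sq_nonneg (‖jH v‖ * ‖D w‖ - ‖D v‖ * ‖jH w‖))]

theorem aux_jH_le (jH : V →ₗ[ℝ] H) (D : V →ₗ[ℝ] W) (k : ℝ) (hk : 0 < k) (v : V) :
    ‖jH v‖ ≤ Real.sqrt k * nVk jH D k v := by
  have hv : 0 ≤ nVk jH D k v := Real.sqrt_nonneg _
  refine aux_le ?_ (by positivity)
  rw [mul_pow, aux_nVk_sq jH D k hk, Real.sq_sqrt hk.le]
  have : k * (1 / k * ‖jH v‖ ^ 2 + ‖D v‖ ^ 2) = ‖jH v‖ ^ 2 + k * ‖D v‖ ^ 2 := by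
    field_simp
  rw [this]
  nlinarith [mul_nonneg hk.le (sq_nonneg ‖D v‖)]

/-- Abstract form of estimate (eq:wTildeK) in the proof of
Lemma lem:b: for `(w_h, χ_h) ∈ U_h`, the function `w̃_h = Θ_h(w_h, χ_h) − w_h`
belongs to `V_h` and satisfies
`‖w̃_h‖_{V,k} ≤ C_B k^{1/2}‖Dw_h‖_W + ‖Θ_h(0, χ_h)‖_{V,k}`; in particular
`‖w̃_h‖_{V,k} ≤ C|||(w_h, χ_h)|||_k` with `C` depending only on `C_B` and `T`. -/
theorem stmt6
    (jH : V →ₗ[ℝ] H) (D : V →ₗ[ℝ] W) (X : Submodule ℝ V)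
    (B : ↥X →ₗ[ℝ] H) (d : S →ₗ[ℝ] V →ₗ[ℝ] ℝ)
    (hjH : Function.Injective ⇑jH)
    (hd : ∀ (σ : S) (x : ↥X), d σ (x : V) = 0)
    (hB : ∀ x : ↥X, 0 ≤ ⟪B x, jH (x : V)⟫)
    (C_B T : ℝ) (hCB : 0 < C_B) (hT : 0 < T)
    (hBbd : ∀ x : ↥X, ‖B x‖ ≤ C_B * ‖D (x : V)‖) :
    ∃ C : ℝ, 0 < C ∧
      ∀ (k : ℝ), 0 < k → k ≤ T →
      ∀ (Xh Vh : Submodule ℝ V) (Sh : Submodule ℝ S), Xh ≤ X ⊓ Vh →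
        FiniteDimensional ℝ ↥Vh → FiniteDimensional ℝ ↥Xh →
        FiniteDimensional ℝ ↥Sh →
      ∀ Θ : ↥X × S → V, IsTrialToTest jH D B d k Vh Θ →
      ∀ u : ↥X × S, memUh Xh Sh u →
        Θ u - (u.1 : V) ∈ Vh ∧
        nVk jH D k (Θ u - (u.1 : V)) ≤
          C_B * Real.sqrt k * ‖D (u.1 : V)‖ + nVk jH D k (Θ (0, u.2)) ∧
        nVk jH D k (Θ u - (u.1 : V)) ≤ C * enormK jH D Θ k u := by
  refine ⟨C_B * Real.sqrt T + 1, by positivity, ?_⟩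
  intro k hk hkT Xh Vh Sh hXh _ _ _ Θ hΘ u hu
  have hmem : Θ u - (u.1 : V) ∈ Vh := Vh.sub_mem (hΘ u).1 (hXh hu.1).2
  have key : nVk jH D k (Θ u - (u.1 : V)) ≤
      C_B * Real.sqrt k * ‖D (u.1 : V)‖ + nVk jH D k (Θ (0, u.2)) := by
    have e1 := (hΘ u).2 _ hmem
    have e2 := (hΘ (0, u.2)).2 _ hmem
    have hsplit : ipVk jH D k (Θ u - (u.1 : V)) (Θ u - (u.1 : V)) =
        ipVk jH D k (Θ u) (Θ u - (u.1 : V)) - ipVk jH D k (u.1 : V) (Θ u - (u.1 : V)) := by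
      generalize hw : Θ u - (u.1 : V) = w
      have : ipVk jH D k w w = ipVk jH D k (Θ u - (u.1 : V)) w := by rw [hw]
      rw [this]
      simp only [ipVk, map_sub, inner_sub_left]
      ring
    generalize Θ u - (u.1 : V) = w at *
    have e3 : ipVk jH D k w w = ⟪B u.1, jH w⟫ + ipVk jH D k (Θ (0, u.2)) w := by
      rw [hsplit, e1, e2]
      simp only [aForm, bForm, ipVk, ZeroMemClass.coe_zero, map_zero, inner_zero_left]
      ring
    have hsq : nVk jH D k w ^ 2 = ipVk jH D k w w := by
      rw [aux_nVk_sq jH D k hk]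
      simp only [ipVk, real_inner_self_eq_norm_sq]
    have hcs := aux_cs jH D k hk (Θ (0, u.2)) w
    have hw0 : 0 ≤ nVk jH D k w := Real.sqrt_nonneg _
    have ht0 : 0 ≤ nVk jH D k (Θ (0, u.2)) := Real.sqrt_nonneg _
    have hb : ⟪B u.1, jH w⟫ ≤ (C_B * ‖D (u.1 : V)‖) * (Real.sqrt k * nVk jH D k w) :=
      (real_inner_le_norm _ _).trans
        (mul_le_mul (hBbd u.1) (aux_jH_le jH D k hk w) (norm_nonneg _) (by positivity))
    rcases hw0.eq_or_lt with h | h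
    · rw [← h]; positivity
    · refine le_of_mul_le_mul_right ?_ h
      nlinarith
  refine ⟨hmem, key, key.trans ?_⟩
  have ht0 : 0 ≤ nVk jH D k (Θ (0, u.2)) := Real.sqrt_nonneg _
  have g1 : ‖D (u.1 : V)‖ ≤ enormK jH D Θ k u :=
    Real.le_sqrt_of_sq_le (by nlinarith [sq_nonneg (nVk jH D k (Θ (0, u.2)))])
  have g2 : nVk jH D k (Θ (0, u.2)) ≤ enormK jH D Θ k u :=
    Real.le_sqrt_of_sq_le (by nlinarith [sq_nonneg ‖D (u.1 : V)‖])
  have g3 : Real.sqrt k ≤ Real.sqrt T := Real.sqrt_le_sqrt hkT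
  calc _ ≤ C_B * Real.sqrt T * enormK jH D Θ k u + enormK jH D Θ k u := by gcongr
    _ = _ := by ring
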